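/- Let X = [−1,1] with the Euclidean metric, let P(X) be the smallest d-structure containing the paths γ1(t) = t and γ2(t) = −t, and let X* be the reversed d-space. Then there exists no d-isometry F : X → X*; in particular, X and X* are not d-isometric. -/

import Mathlib

open scoped ENNReal

noncomputable section

/-- The length of a path `γ : ℝ → X`: its total variation on `[0,1]`. -/
def pathLen {X : Type*} [PseudoEMetricSpace X] (γ : ℝ → X) : ℝ≥0∞ :=
  eVariationOn γ (Set.Icc 0 1)

/-- `P` is a d-space structure on `X`: it contains all constant paths, is closed under
precomposition with continuous nondecreasing maps `[0,1] → [0,1]`, and is closed under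
concatenation; all members are continuous on `[0,1]`. -/
structure IsDSpace {X : Type*} [MetricSpace X] (P : Set (ℝ → X)) : Prop where
  cont : ∀ γ ∈ P, ContinuousOn γ (Set.Icc (0:ℝ) 1)
  const_mem : ∀ x : X, (fun _ : ℝ => x) ∈ P
  reparam : ∀ γ ∈ P, ∀ h : ℝ → ℝ, ContinuousOn h (Set.Icc (0:ℝ) 1) →
    MonotoneOn h (Set.Icc (0:ℝ) 1) → Set.MapsTo h (Set.Icc (0:ℝ) 1) (Set.Icc (0:ℝ) 1) →
    γ ∘ h ∈ P
  concat : ∀ γ ∈ P, ∀ γ' ∈ P, γ 1 = γ' 0 →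
    (fun t : ℝ => if t ≤ 1/2 then γ (2*t) else γ' (2*t - 1)) ∈ P

/-- A d-structure is rectifiable if every d-path has finite length. -/
def IsRectifiable {X : Type*} [MetricSpace X] (P : Set (ℝ → X)) : Prop :=
  ∀ γ ∈ P, pathLen γ ≠ ⊤

/-- `γ` is a d-path from `x` to `x'`. -/
def IsDPathFrom {X : Type*} (P : Set (ℝ → X)) (x x' : X) (γ : ℝ → X) : Prop :=
  γ ∈ P ∧ γ 0 = x ∧ γ 1 = x'

/-- `L` is a zigzag path between `x` and `x'`: a finite sequence of d-paths, each joining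
consecutive points `p i`, `p (i+1)` in one direction or the other. -/
def IsZigzagFrom {X : Type*} (P : Set (ℝ → X)) (x x' : X) (L : List (ℝ → X)) : Prop :=
  ∃ p : ℕ → X, p 0 = x ∧ p L.length = x' ∧
    ∀ i : Fin L.length,
      IsDPathFrom P (p i) (p (i + 1)) (L.get i) ∨ IsDPathFrom P (p (i + 1)) (p i) (L.get i)

/-- The length of a zigzag path: the sum of the lengths of its pieces. -/
def zigzagLen {X : Type*} [PseudoEMetricSpace X] (L : List (ℝ → X)) : ℝ≥0∞ :=
  (L.map pathLen).sum

/-- The zigzag (extended) distance induced by a d-structure `P`. -/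
def zzDist {X : Type*} [MetricSpace X] (P : Set (ℝ → X)) (x x' : X) : ℝ≥0∞ :=
  ⨅ L ∈ {L : List (ℝ → X) | IsZigzagFrom P x x' L}, zigzagLen L

/-- Any two points are joined by a zigzag path. -/
def ZigzagConnected {X : Type*} (P : Set (ℝ → X)) : Prop :=
  ∀ x x' : X, ∃ L, IsZigzagFrom P x x' L

/-- A d-map: continuous and sending d-paths to d-paths. -/
def IsDMap {X Y : Type*} [MetricSpace X] [MetricSpace Y]
    (PX : Set (ℝ → X)) (PY : Set (ℝ → Y)) (F : X → Y) : Prop :=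
  Continuous F ∧ ∀ γ ∈ PX, F ∘ γ ∈ PY

/-- The reversed d-structure: `γ ∈ reverseP P` iff `t ↦ γ (1 - t)` belongs to `P`. -/
def reverseP {X : Type*} (P : Set (ℝ → X)) : Set (ℝ → X) :=
  {γ | (fun t => γ (1 - t)) ∈ P}

/-- `|a - b|` for extended nonnegative reals. -/
def ediffAbs (a b : ℝ≥0∞) : ℝ≥0∞ := (a - b) ⊔ (b - a)

/-- Distortion of a map with respect to extended distances on source and target. -/
def edis {X Y : Type*} (dX : X → X → ℝ≥0∞) (dY : Y → Y → ℝ≥0∞) (F : X → Y) : ℝ≥0∞ :=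
  ⨆ x : X, ⨆ x' : X, ediffAbs (dX x x') (dY (F x) (F x'))

/-- Codistortion of a pair of maps with respect to extended distances. -/
def ecodis {X Y : Type*} (dX : X → X → ℝ≥0∞) (dY : Y → Y → ℝ≥0∞)
    (F : X → Y) (G : Y → X) : ℝ≥0∞ :=
  ⨆ x : X, ⨆ y : Y, ediffAbs (dX x (G y)) (dY (F x) y)

/-- The distortion distance between two d-spaces: half the infimum, over pairs of d-maps,
of the maximum of the two distortions and the codistortion (w.r.t. zigzag distances). -/
def ddis {X Y : Type*} [MetricSpace X] [MetricSpace Y]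
    (PX : Set (ℝ → X)) (PY : Set (ℝ → Y)) : ℝ≥0∞ :=
  (1/2 : ℝ≥0∞) * ⨅ (F : {F : X → Y // IsDMap PX PY F}) (G : {G : Y → X // IsDMap PY PX G}),
    max (edis (zzDist PX) (zzDist PY) F.1)
      (max (edis (zzDist PY) (zzDist PX) G.1) (ecodis (zzDist PX) (zzDist PY) F.1 G.1))

/-- A d-correspondence: a relation with surjective projections that matches reachability. -/
def IsDCorrespondence {X Y : Type*} (PX : Set (ℝ → X)) (PY : Set (ℝ → Y))
    (R : Set (X × Y)) : Prop :=
  (∀ x : X, ∃ y : Y, (x, y) ∈ R) ∧ (∀ y : Y, ∃ x : X, (x, y) ∈ R) ∧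
  ∀ p ∈ R, ∀ q ∈ R,
    ((∃ γ, IsDPathFrom PX p.1 q.1 γ) ↔ (∃ γ, IsDPathFrom PY p.2 q.2 γ))

/-- Distortion of a correspondence with respect to the zigzag distances. -/
def corDis {X Y : Type*} [MetricSpace X] [MetricSpace Y]
    (PX : Set (ℝ → X)) (PY : Set (ℝ → Y)) (R : Set (X × Y)) : ℝ≥0∞ :=
  ⨆ p : R, ⨆ q : R, ediffAbs (zzDist PX p.1.1 q.1.1) (zzDist PY p.1.2 q.1.2)

/-- The d-correspondence distortion distance. -/
def dcdis {X Y : Type*} [MetricSpace X] [MetricSpace Y]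
    (PX : Set (ℝ → X)) (PY : Set (ℝ → Y)) : ℝ≥0∞ :=
  (1/2 : ℝ≥0∞) * ⨅ R : {R : Set (X × Y) // IsDCorrespondence PX PY R}, corDis PX PY R.1

/-- Hausdorff distance between two subsets w.r.t. an extended distance. -/
def ehausdorffDist {Z : Type*} (d : Z → Z → ℝ≥0∞) (s t : Set Z) : ℝ≥0∞ :=
  max (⨆ a ∈ s, ⨅ b ∈ t, d a b) (⨆ b ∈ t, ⨅ a ∈ s, d a b)

/-- The interval `[-1, 1]` with the Euclidean metric. -/
abbrev MInt : Type := {x : ℝ // x ∈ Set.Icc (-1:ℝ) 1}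

/-- Clamp a real number into `[-1, 1]`. -/
def clampM (t : ℝ) : MInt :=
  ⟨max (-1) (min 1 t), ⟨le_max_left _ _, max_le (by norm_num) (min_le_left _ _)⟩⟩

/-- The path `γ₁(t) = t` (for `t ∈ [0,1]`). -/
def gone : ℝ → MInt := fun t => clampM t

/-- The path `γ₂(t) = -t` (for `t ∈ [0,1]`). -/
def gtwo : ℝ → MInt := fun t => clampM (-t)

/-- The smallest d-structure on `[-1,1]` containing `γ₁` and `γ₂`: the intersection of all
d-structures containing them. -/
def mintP : Set (ℝ → MInt) :=
  ⋂₀ {P : Set (ℝ → MInt) | IsDSpace P ∧ {gone, gtwo} ⊆ P}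

/-- `b` lies weakly further from `0` than `a`, on the same side. -/
def IsFartherSameSide (a b : ℝ) : Prop := (0 ≤ a ∧ a ≤ b) ∨ (b ≤ a ∧ a ≤ 0)

theorem IsFartherSameSide.refl (a : ℝ) : IsFartherSameSide a a := by
  rcases le_total 0 a with h | h
  · exact Or.inl ⟨h, le_rfl⟩
  · exact Or.inr ⟨le_rfl, h⟩

theorem IsFartherSameSide.trans {a b c : ℝ} (hab : IsFartherSameSide a b)
    (hbc : IsFartherSameSide b c) : IsFartherSameSide a c := by
  unfold IsFartherSameSide at *
  grind

theorem continuousOn_concat {X : Type*} [TopologicalSpace X] {γ γ' : ℝ → X}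
    (hγ : ContinuousOn γ (Set.Icc 0 1)) (hγ' : ContinuousOn γ' (Set.Icc 0 1))
    (h : γ 1 = γ' 0) :
    ContinuousOn (fun t : ℝ => if t ≤ 1/2 then γ (2*t) else γ' (2*t - 1)) (Set.Icc 0 1) := by
  have hleft : ContinuousOn (fun t : ℝ => if t ≤ 1/2 then γ (2*t) else γ' (2*t - 1))
      (Set.Icc 0 (1/2)) := by
    refine (hγ.comp (f := fun t : ℝ => 2 * t) (s := Set.Icc 0 (1/2)) (by fun_prop)
      fun t ht => ⟨by linarith [ht.1], by linarith [ht.2]⟩).congr fun t ht => ?_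
    simp only [if_pos ht.2, Function.comp]
  have hright : ContinuousOn (fun t : ℝ => if t ≤ 1/2 then γ (2*t) else γ' (2*t - 1))
      (Set.Icc (1/2) 1) := by
    refine (hγ'.comp (f := fun t : ℝ => 2 * t - 1) (s := Set.Icc (1/2) 1) (by fun_prop)
      fun t ht => ⟨by linarith [ht.1], by linarith [ht.2]⟩).congr fun t ht => ?_
    rcases eq_or_lt_of_le ht.1 with rfl | hlt
    · norm_num [h]
    · simp only [if_neg hlt.not_ge, Function.comp]
  rw [← Set.Icc_union_Icc_eq_Icc (a := (0:ℝ)) (b := 1/2) (c := 1) (by norm_num) (by norm_num)]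
  exact hleft.union_of_isClosed hright isClosed_Icc isClosed_Icc

/-- The paths in `[-1,1]` that move away from `0` without changing side. -/
def outwardPaths : Set (ℝ → MInt) :=
  {γ | ContinuousOn γ (Set.Icc 0 1) ∧ ∀ s ∈ Set.Icc (0:ℝ) 1, ∀ t ∈ Set.Icc (0:ℝ) 1, s ≤ t →
    IsFartherSameSide (γ s) (γ t)}

theorem isDSpace_outwardPaths : IsDSpace outwardPaths where
  cont γ hγ := hγ.1
  const_mem x := ⟨continuousOn_const, fun _ _ _ _ _ => .refl _⟩
  reparam γ hγ h hc hm hI :=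
    ⟨hγ.1.comp hc hI, fun s hs t ht hst => hγ.2 _ (hI hs) _ (hI ht) (hm hs ht hst)⟩
  concat γ hγ γ' hγ' h := by
    refine ⟨continuousOn_concat hγ.1 hγ'.1 h, fun s hs t ht hst => ?_⟩
    have hs0 := hs.1
    have ht1 := ht.2
    by_cases hs2 : s ≤ 1/2 <;> by_cases ht2 : t ≤ 1/2
    · simp only [if_pos hs2, if_pos ht2]
      exact hγ.2 _ ⟨by linarith, by linarith⟩ _ ⟨by linarith, by linarith⟩ (by linarith)
    · simp only [if_pos hs2, if_neg ht2]
      rw [not_le] at ht2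
      have h₁ := hγ.2 (2 * s) ⟨by linarith, by linarith⟩ 1 (by norm_num) (by linarith)
      have h₂ := hγ'.2 0 (by norm_num) (2 * t - 1) ⟨by linarith, by linarith⟩ (by linarith)
      rw [← h] at h₂
      exact h₁.trans h₂
    · exact absurd (hst.trans ht2) hs2
    · simp only [if_neg hs2, if_neg ht2]
      rw [not_le] at hs2 ht2
      exact hγ'.2 _ ⟨by linarith, by linarith⟩ _ ⟨by linarith, by linarith⟩ (by linarith)

theorem coe_clampM {t : ℝ} (ht : t ∈ Set.Icc (-1:ℝ) 1) : (clampM t : ℝ) = t := by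
  simp [clampM, ht.1, ht.2]

theorem clampM_coe (x : MInt) : clampM x = x := Subtype.ext (coe_clampM x.2)

theorem lipschitzWith_clampM : LipschitzWith 1 clampM :=
  LipschitzWith.of_edist_le fun x y => by
    have := ((LipschitzWith.id.const_min (1:ℝ)).const_max (-1)).edist_le_mul x y
    simpa [clampM, Subtype.edist_eq] using this

theorem lipschitzWith_gtwo : LipschitzWith 1 gtwo := by
  have := lipschitzWith_clampM.comp (LipschitzWith.id (α := ℝ)).neg
  rwa [one_mul] at this

theorem mintP_subset_outwardPaths : mintP ⊆ outwardPaths := by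
  refine Set.sInter_subset_of_mem ⟨isDSpace_outwardPaths, ?_⟩
  rintro γ (rfl | rfl)
  · refine ⟨lipschitzWith_clampM.continuous.continuousOn, fun s hs t ht hst => Or.inl ?_⟩
    simp only [gone]
    rw [coe_clampM ⟨by linarith [hs.1], hs.2⟩, coe_clampM ⟨by linarith [ht.1], ht.2⟩]
    exact ⟨hs.1, hst⟩
  · refine ⟨lipschitzWith_gtwo.continuous.continuousOn,
      fun s hs t ht hst => Or.inr ?_⟩
    simp only [gtwo]
    have hs0 := hs.1
    have ht1 := ht.2
    rw [coe_clampM ⟨by linarith, by linarith⟩, coe_clampM ⟨by linarith, by linarith⟩]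
    exact ⟨by linarith, by linarith⟩

theorem gone_mem_mintP : gone ∈ mintP := fun _ hP => hP.2 (Or.inl rfl)

theorem gtwo_mem_mintP : gtwo ∈ mintP := fun _ hP => hP.2 (Or.inr rfl)

theorem comp_mem_mintP {γ : ℝ → MInt} (hγ : γ ∈ mintP) {h : ℝ → ℝ}
    (hc : ContinuousOn h (Set.Icc 0 1)) (hm : MonotoneOn h (Set.Icc 0 1))
    (hI : Set.MapsTo h (Set.Icc 0 1) (Set.Icc 0 1)) : γ ∘ h ∈ mintP :=
  fun P hP => hP.1.reparam γ (hγ P hP) h hc hm hI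

theorem zzDist_le_pathLen {X : Type*} [MetricSpace X] {P : Set (ℝ → X)} {x y : X}
    {γ : ℝ → X} (h : IsDPathFrom P x y γ ∨ IsDPathFrom P y x γ) :
    zzDist P x y ≤ pathLen γ := by
  refine (iInf₂_le [γ] ⟨fun n => if n = 0 then x else y, by simp, by simp, ?_⟩).trans
    (by simp [zigzagLen])
  intro i
  have hi : i = ⟨0, by simp⟩ := Fin.ext (by have := i.2; simp at this ⊢)
  subst hi
  simpa using h

theorem edist_le_zzDist {X : Type*} [MetricSpace X] (P : Set (ℝ → X)) (x y : X) :
    edist x y ≤ zzDist P x y := by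
  refine le_iInf₂ fun L hL => ?_
  obtain ⟨p, rfl, rfl, hp⟩ := hL
  refine (edist_le_range_sum_edist p L.length).trans ?_
  have hsum : zigzagLen L = ∑ i : Fin L.length, pathLen (L.get i) := by
    simp [zigzagLen, Fin.sum_univ_fun_getElem]
  rw [hsum, Finset.sum_range]
  refine Finset.sum_le_sum fun i _ => ?_
  have hle : edist (L.get i 0) (L.get i 1) ≤ pathLen (L.get i) :=
    eVariationOn.edist_le _ (by norm_num) (by norm_num)
  rcases hp i with ⟨-, h0, h1⟩ | ⟨-, h0, h1⟩
  · rwa [h0, h1] at hle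
  · rwa [h0, h1, edist_comm] at hle

theorem pathLen_le_one_of_lipschitzWith {X : Type*} [PseudoEMetricSpace X] {γ : ℝ → X}
    (h : LipschitzWith 1 γ) : pathLen γ ≤ 1 := by
  have h₁ := (h.lipschitzOnWith (s := Set.univ)).comp_eVariationOn_le
    (f := γ) (g := (id : ℝ → ℝ)) (s := Set.Icc 0 1) (fun _ _ => trivial)
  have h₂ := (monotone_id.monotoneOn (Set.Icc (0:ℝ) 1)).eVariationOn_eq
    (a := 0) (b := 1) (by norm_num) (by norm_num)
  simp only [Set.inter_self] at h₂
  exact h₁.trans (by simp [h₂])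

/-- Two points on a unit-speed outward ray of `mintP` are at reversed zigzag distance at
most `1`. -/
theorem zzDist_reverseP_le_one_of_ray {γ : ℝ → MInt} (hγ : γ ∈ mintP) (hl : LipschitzWith 1 γ)
    {a b : ℝ} (ha : a ∈ Set.Icc (0:ℝ) 1) (hb : b ∈ Set.Icc (0:ℝ) 1) :
    zzDist (reverseP mintP) (γ a) (γ b) ≤ 1 := by
  have key : ∀ a ∈ Set.Icc (0:ℝ) 1, ∀ b ∈ Set.Icc (0:ℝ) 1, a ≤ b →
      ∃ δ : ℝ → MInt, IsDPathFrom (reverseP mintP) (γ b) (γ a) δ ∧ pathLen δ ≤ 1 := by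
    intro a ha b hb hab
    have hab1 : b - a ≤ 1 := by linarith [ha.1, hb.2]
    refine ⟨fun t => γ (a + (b - a) * (1 - t)), ⟨?_, by simp, by simp⟩, ?_⟩
    · refine comp_mem_mintP (h := fun t => a + (b - a) * (1 - (1 - t))) hγ (by fun_prop) ?_ ?_
      · intro s _ t _ hst
        dsimp only
        nlinarith
      · intro t ht
        constructor <;> dsimp only <;> nlinarith [ha.1, hb.2, ht.1, ht.2]
    · refine pathLen_le_one_of_lipschitzWith ?_
      have : LipschitzWith 1 fun t : ℝ => a + (b - a) * (1 - t) := by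
        refine LipschitzWith.of_dist_le_mul fun x y => ?_
        rw [Real.dist_eq, Real.dist_eq,
          show a + (b - a) * (1 - x) - (a + (b - a) * (1 - y)) = -((b - a) * (x - y)) by ring,
          abs_neg, abs_mul, abs_of_nonneg (sub_nonneg.2 hab)]
        exact mul_le_mul_of_nonneg_right hab1 (abs_nonneg _)
      simpa [Function.comp_def] using hl.comp this
  rcases le_total a b with hab | hab
  · obtain ⟨δ, hδ, hlen⟩ := key a ha b hb hab
    exact (zzDist_le_pathLen (.inr hδ)).trans hlen
  · obtain ⟨δ, hδ, hlen⟩ := key b hb a ha hab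
    exact (zzDist_le_pathLen (.inl hδ)).trans hlen

theorem zzDist_reverseP_le_one {u v w : MInt} (hu : IsFartherSameSide u w)
    (hv : IsFartherSameSide v w) : zzDist (reverseP mintP) u v ≤ 1 := by
  have h : (0 ≤ (u:ℝ) ∧ 0 ≤ (v:ℝ)) ∨ ((u:ℝ) ≤ 0 ∧ (v:ℝ) ≤ 0) := by
    unfold IsFartherSameSide at hu hv
    grind
  rcases h with ⟨h₁, h₂⟩ | ⟨h₁, h₂⟩
  · have := zzDist_reverseP_le_one_of_ray gone_mem_mintP lipschitzWith_clampM
      (a := u) (b := v) ⟨h₁, u.2.2⟩ ⟨h₂, v.2.2⟩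
    simpa only [gone, clampM_coe] using this
  · have := zzDist_reverseP_le_one_of_ray gtwo_mem_mintP
      lipschitzWith_gtwo
      (a := -u) (b := -v) ⟨by linarith, by linarith [u.2.1]⟩ ⟨by linarith, by linarith [v.2.1]⟩
    simpa only [gtwo, neg_neg, clampM_coe] using this

theorem isFartherSameSide_of_isDMap {F : MInt → MInt} (hF : IsDMap mintP (reverseP mintP) F)
    {γ : ℝ → MInt} (hγ : γ ∈ mintP) : IsFartherSameSide (F (γ 1)) (F (γ 0)) := by
  have := (mintP_subset_outwardPaths (hF.2 γ hγ)).2 0 (by norm_num) 1 (by norm_num) zero_le_one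
  simpa using this

theorem not_exists_dIsometry_mintP_reverseP :
    ¬ ∃ F : MInt → MInt, IsDMap mintP (reverseP mintP) F ∧
        ∀ x x' : MInt, zzDist (reverseP mintP) (F x) (F x') = zzDist mintP x x' := by
  rintro ⟨F, hF, hiso⟩
  have h₁ := isFartherSameSide_of_isDMap hF gone_mem_mintP
  have h₂ := isFartherSameSide_of_isDMap hF gtwo_mem_mintP
  rw [show gtwo 0 = gone 0 by simp [gone, gtwo]] at h₂
  have hle := (edist_le_zzDist mintP (gone 1) (gtwo 1)).trans
    ((hiso _ _).symm.le.trans (zzDist_reverseP_le_one h₁ h₂))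
  rw [edist_dist, ENNReal.ofReal_le_one, Subtype.dist_eq, gone, gtwo, coe_clampM (by norm_num),
    coe_clampM (by norm_num), Real.dist_eq] at hle
  norm_num at hle

/-- There is no d-isometry from `X = ([-1,1], ⟨γ₁, γ₂⟩)` to its reversed
d-space `X*`; in particular, `X` and `X*` are not d-isometric. -/
theorem no_dIsometry_mint_reverse :
    (¬ ∃ F : MInt → MInt, IsDMap mintP (reverseP mintP) F ∧
        ∀ x x' : MInt, zzDist (reverseP mintP) (F x) (F x') = zzDist mintP x x') ∧
    (¬ ∃ F : MInt → MInt, IsDMap mintP (reverseP mintP) F ∧ Function.Bijective F ∧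
        (∀ x x' : MInt, zzDist (reverseP mintP) (F x) (F x') = zzDist mintP x x') ∧
        ∃ G : MInt → MInt, IsDMap (reverseP mintP) mintP G ∧
          Function.LeftInverse G F ∧ Function.RightInverse G F) :=
  ⟨not_exists_dIsometry_mintP_reverseP,
    fun ⟨F, hF, _, hiso, _⟩ => not_exists_dIsometry_mintP_reverseP ⟨F, hF, hiso⟩⟩

end
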